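/- For every bounded rectangle A in [0,1]^d and all reals x < y (y = +∞ allowed, with the conventions u_N(+∞) = +∞ and e^{−∞} = 0), the sum over α ∈ nA ∩ V_N of P(u_N(x) < ψ_α ≤ u_N(y)) converges, as n → ∞, to |A|·(e^{−x} − e^{−y}). -/

import Mathlib

open MeasureTheory ProbabilityTheory Real Filter Set

/-- `ℤ^d` as functions `Fin d → ℤ`. -/
abbrev Zd (d : ℕ) := Fin d → ℤ

/-- One step of the simple random walk: move from `a` by `±1` in coordinate `i`. -/
def rwStep (d : ℕ) (i : Fin d) (s : Bool) (a : Zd d) : Zd d :=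
  Function.update a i (a i + if s then 1 else -1)

/-- `m`-step transition probability of the simple random walk on `ℤ^d`. -/
noncomputable def rwP (d : ℕ) : ℕ → Zd d → Zd d → ℝ
  | 0, a, b => if a = b then 1 else 0
  | (m+1), a, b => (1 / (2 * d)) * ∑ i : Fin d, ∑ s : Bool, rwP d m (rwStep d i s a) b

/-- The Green's function `g(a,b)` of the simple random walk on `ℤ^d`. -/
noncomputable def green (d : ℕ) (a b : Zd d) : ℝ := ∑' m, rwP d m a b

open Classical in
/-- Probability that the walk started at `a` is at `b` at time `m`, having stayed in `Λ`
at all times `0,…,m`. -/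
noncomputable def rwPIn (d : ℕ) (Λ : Set (Zd d)) : ℕ → Zd d → Zd d → ℝ
  | 0, a, b => if a = b ∧ a ∈ Λ then 1 else 0
  | (m+1), a, b =>
      if a ∈ Λ then (1 / (2 * d)) * ∑ i : Fin d, ∑ s : Bool, rwPIn d Λ m (rwStep d i s a) b
      else 0

/-- Dirichlet Green's function `g_Λ(a,b)` (killed upon exiting `Λ`). -/
noncomputable def greenIn (d : ℕ) (Λ : Set (Zd d)) (a b : Zd d) : ℝ := ∑' m, rwPIn d Λ m a b

open Classical in
/-- Probability that the walk started at `a` first hits `F` at time `m`, at the point `b`. -/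
noncomputable def hitP (d : ℕ) (F : Set (Zd d)) : ℕ → Zd d → Zd d → ℝ
  | 0, a, b => if a = b ∧ b ∈ F then 1 else 0
  | (m+1), a, b =>
      if a ∈ F then 0
      else (1 / (2 * d)) * ∑ i : Fin d, ∑ s : Bool, hitP d F m (rwStep d i s a) b

open Classical in
/-- Probability that the walk started at `a` first hits `F` at time `m`, at the point `b`,
before exiting `Λ`. -/
noncomputable def hitPIn (d : ℕ) (Λ F : Set (Zd d)) : ℕ → Zd d → Zd d → ℝ
  | 0, a, b => if a = b ∧ b ∈ F ∧ b ∈ Λ then 1 else 0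
  | (m+1), a, b =>
      if a ∈ Λ ∧ a ∉ F then
        (1 / (2 * d)) * ∑ i : Fin d, ∑ s : Bool, hitPIn d Λ F m (rwStep d i s a) b
      else 0

/-- `ℙ_a(H_F < ∞, S_{H_F} = b)`, the harmonic measure of `F` seen from `a`. -/
noncomputable def hitMeas (d : ℕ) (F : Set (Zd d)) (a b : Zd d) : ℝ := ∑' m, hitP d F m a b

/-- `ℙ_a(H_F < H_{ℤ^d∖Λ}, S_{H_F} = b)`. -/
noncomputable def hitMeasIn (d : ℕ) (Λ F : Set (Zd d)) (a b : Zd d) : ℝ :=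
  ∑' m, hitPIn d Λ F m a b

/-- `(φ_a)_{a∈ℤ^d}` is a centered Gaussian field with covariance `G`: every finite linear
combination is a centered Gaussian with the prescribed variance. -/
def IsGaussianField {Ω : Type*} [MeasurableSpace Ω] (P : Measure Ω) (d : ℕ)
    (G : Zd d → Zd d → ℝ) (φ : Zd d → Ω → ℝ) : Prop :=
  (∀ a, Measurable (φ a)) ∧
    ∀ c : Zd d →₀ ℝ,
      Measure.map (fun ω => ∑ a ∈ c.support, c a * φ a ω) P =
        gaussianReal 0
          (Real.toNNReal (∑ a ∈ c.support, ∑ b ∈ c.support, c a * c b * G a b))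

/-- The centering sequence `b_N` (here `g0 = g(0)` is the variance of the field). -/
noncomputable def bN (g0 : ℝ) (N : ℕ) : ℝ :=
  Real.sqrt g0 * (Real.sqrt (2 * Real.log N) -
    (Real.log (Real.log N) + Real.log (4 * π)) / (2 * Real.sqrt (2 * Real.log N)))

/-- The scaling sequence `a_N = g(0)/b_N`. -/
noncomputable def aN (g0 : ℝ) (N : ℕ) : ℝ := g0 / bN g0 N

/-- `u_N(z) = a_N z + b_N`. -/
noncomputable def uN (g0 : ℝ) (N : ℕ) (z : ℝ) : ℝ := aN g0 N * z + bN g0 N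

/-- The box `V_N = ([0,n-1]^d) ∩ ℤ^d`, `N = n^d`. -/
noncomputable def VN (d n : ℕ) : Finset (Zd d) :=
  Fintype.piFinset fun _ => Finset.Icc (0 : ℤ) ((n : ℤ) - 1)

/-- The `ℓ∞` distance between two points of `ℤ^d`, as a real number. -/
noncomputable def distInf (d : ℕ) (a b : Zd d) : ℝ :=
  ((Finset.univ.sup fun i => (a i - b i).natAbs : ℕ) : ℝ)

open Classical in
/-- The bulk `V_N^δ` of the box `V_N`. -/
noncomputable def bulk (d n : ℕ) (δ : ℝ) : Finset (Zd d) :=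
  (VN d n).filter fun a => ∀ b : Zd d, b ∉ VN d n → δ * n < distInf d a b

/-- The rectangle `∏_i ([0,1] ∩ (lo i, hi i])` in `[0,1]^d`. -/
def rect (d : ℕ) (lo hi : Fin d → ℝ) : Set (Fin d → ℝ) :=
  {t | ∀ i, t i ∈ Set.Icc (0 : ℝ) 1 ∩ Set.Ioc (lo i) (hi i)}

open Classical in
/-- `nA ∩ V_N = {α ∈ V_N : α/n ∈ A}` for the rectangle `A = rect d lo hi`. -/
noncomputable def rectIdx (d n : ℕ) (lo hi : Fin d → ℝ) : Finset (Zd d) :=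
  (VN d n).filter fun a => (fun i => (a i : ℝ) / n) ∈ rect d lo hi

/-- `e^{-y}` for `y ∈ (-∞,+∞]`, with the convention `e^{-∞} = 0`. -/
noncomputable def expE (y : EReal) : ℝ := if y = ⊤ then 0 else Real.exp (-y.toReal)

/-- `u_N` extended to `(-∞,+∞]` by `u_N(+∞) = +∞`. -/
noncomputable def uNE (g0 : ℝ) (N : ℕ) (y : EReal) : EReal :=
  if y = ⊤ then ⊤ else ((uN g0 N y.toReal : ℝ) : EReal)

/-- `ω(R) = ∫_R e^{-z} dz` for `R ⊆ (-∞,+∞]`. -/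
noncomputable def omegaMeas (R : Set EReal) : ℝ :=
  ∫ t in {t : ℝ | (t : EReal) ∈ R}, Real.exp (-t)

/-- `R ⊆ (-∞,+∞]` is a finite union of disjoint intervals `(x,y]` with
`-∞ < x < y ≤ +∞`. -/
def IsFiniteUnionIoc (R : Set EReal) : Prop :=
  ∃ (m : ℕ) (w : Fin m → ℝ) (r : Fin m → EReal),
    (∀ l, (w l : EReal) < r l) ∧
    (Pairwise fun l l' =>
      Disjoint (Set.Ioc (w l : EReal) (r l)) (Set.Ioc (w l' : EReal) (r l'))) ∧
    R = ⋃ l, Set.Ioc ((w l : ℝ) : EReal) (r l)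


/-- The uniform measure on the cube `(0,1]^d`. -/
noncomputable def unitCubeMeasure (d : ℕ) : Measure (Fin d → ℝ) :=
  Measure.pi fun _ => volume.restrict (Set.Ioc (0 : ℝ) 1)

instance isProbabilityMeasure_restrict_Ioc_zero_one :
    IsProbabilityMeasure (volume.restrict (Set.Ioc (0 : ℝ) 1)) :=
  ⟨by simp⟩

instance isProbabilityMeasure_unitCubeMeasure (d : ℕ) :
    IsProbabilityMeasure (unitCubeMeasure d) := by
  unfold unitCubeMeasure; infer_instance

/-- The characteristic function of a step of the simple random walk. -/
noncomputable def stepChar (d : ℕ) (θ : Fin d → ℝ) : ℝ :=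
  (∑ i, Real.cos (2 * π * θ i)) / d

@[fun_prop]
lemma continuous_stepChar (d : ℕ) : Continuous (stepChar d) := by
  unfold stepChar; fun_prop

lemma abs_stepChar_le_one (d : ℕ) (θ : Fin d → ℝ) : |stepChar d θ| ≤ 1 := by
  unfold stepChar
  rw [abs_div, Nat.abs_cast]
  refine div_le_one_of_le₀ ((Finset.abs_sum_le_sum_abs _ _).trans ?_) (Nat.cast_nonneg d)
  simpa using Finset.sum_le_sum (s := Finset.univ)
    fun i _ => Real.abs_cos_le_one (2 * π * θ i)

lemma integral_cexp_int (k : ℤ) :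
    ∫ t in Set.Ioc (0 : ℝ) 1, Complex.exp (2 * π * Complex.I * k * t) = if k = 0 then 1 else 0 := by
  split_ifs with hk
  · simp [hk]
  · rw [← intervalIntegral.integral_of_le zero_le_one, integral_exp_mul_complex]
    · have : Complex.exp (2 * π * Complex.I * k) = 1 := by
        rw [Complex.exp_eq_one_iff]; exact ⟨k, by ring⟩
      simp [this]
    · simp [hk, Real.pi_ne_zero]

lemma integral_cos_unitCube (d : ℕ) (k : Zd d) :
    ∫ θ, Real.cos (2 * π * ∑ i, θ i * (k i : ℝ)) ∂unitCubeMeasure d = if k = 0 then 1 else 0 := by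
  have h := integral_fintype_prod_eq_prod (𝕜 := ℂ)
    (μ := fun _ : Fin d => volume.restrict (Set.Ioc (0 : ℝ) 1))
    (fun i (t : ℝ) => Complex.exp (2 * π * Complex.I * k i * t))
  simp only [integral_cexp_int, ← Complex.exp_sum] at h
  have hre := congrArg Complex.re h
  have hphase : ∀ θ : Fin d → ℝ, ∑ i, 2 * (π : ℂ) * Complex.I * k i * θ i =
      ((2 * π * ∑ i, θ i * (k i : ℝ) : ℝ) : ℂ) * Complex.I := by
    intro θ
    push_cast
    rw [Finset.mul_sum, Finset.sum_mul]
    exact Finset.sum_congr rfl fun i _ => by ring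
  simp only [hphase] at hre
  have hInt : Integrable (fun θ : Fin d → ℝ =>
      Complex.exp (((2 * π * ∑ i, θ i * (k i : ℝ) : ℝ) : ℂ) * Complex.I)) (unitCubeMeasure d) :=
    Integrable.of_bound (C := 1) (Continuous.aestronglyMeasurable (by fun_prop))
      (ae_of_all _ fun θ => (Complex.norm_exp_ofReal_mul_I _).le)
  have hcomm := integral_re (𝕜 := ℂ) hInt
  simp only [RCLike.re_eq_complex_re, Complex.exp_ofReal_mul_I_re] at hcomm
  rw [hcomm]
  refine hre.trans ?_
  rw [Finset.prod_ite_zero]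
  simp only [Finset.mem_univ, forall_const, Finset.prod_const_one, funext_iff, Pi.zero_apply]
  split_ifs <;> simp

lemma sum_cos_rwStep (d : ℕ) (θ : Fin d → ℝ) (a b : Zd d) :
    (1 / (2 * d) : ℝ) * ∑ i : Fin d, ∑ s : Bool,
      Real.cos (2 * π * ∑ j, θ j * ((rwStep d i s a j - b j : ℤ) : ℝ)) =
    Real.cos (2 * π * ∑ j, θ j * ((a j - b j : ℤ) : ℝ)) * stepChar d θ := by
  have key : ∀ i : Fin d, ∀ s : Bool, ∑ j, θ j * ((rwStep d i s a j - b j : ℤ) : ℝ) =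
      ∑ j, θ j * ((a j - b j : ℤ) : ℝ) + θ i * (if s then 1 else -1) := by
    intro i s
    have : ∀ j, θ j * ((rwStep d i s a j - b j : ℤ) : ℝ) = θ j * ((a j - b j : ℤ) : ℝ) +
        if j = i then θ i * (if s then 1 else -1) else 0 := by
      intro j
      by_cases hj : j = i
      · subst hj
        cases s <;> simp [rwStep] <;> ring
      · simp [rwStep, hj]
    rw [Finset.sum_congr rfl fun j _ => this j, Finset.sum_add_distrib]
    simp
  have hpair : ∀ i : Fin d, ∑ s : Bool,
      Real.cos (2 * π * ∑ j, θ j * ((rwStep d i s a j - b j : ℤ) : ℝ)) =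
      2 * Real.cos (2 * π * ∑ j, θ j * ((a j - b j : ℤ) : ℝ)) * Real.cos (2 * π * θ i) := by
    intro i
    simp only [key, Fintype.sum_bool, if_true, Bool.false_eq_true, if_false, mul_add, mul_one,
      mul_neg, Real.cos_add, Real.cos_neg, Real.sin_neg]
    ring
  rw [Finset.sum_congr rfl fun i _ => hpair i, ← Finset.mul_sum, stepChar]
  by_cases hd : (d : ℝ) = 0
  · simp [hd]
  · field_simp

lemma rwP_eq_integral (d : ℕ) (m : ℕ) (a b : Zd d) :
    rwP d m a b = ∫ θ, Real.cos (2 * π * ∑ i, θ i * ((a i - b i : ℤ) : ℝ)) * stepChar d θ ^ m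
      ∂unitCubeMeasure d := by
  have hInt : ∀ (m : ℕ) (a : Zd d), Integrable
      (fun θ => Real.cos (2 * π * ∑ i, θ i * ((a i - b i : ℤ) : ℝ)) * stepChar d θ ^ m)
      (unitCubeMeasure d) := by
    intro m a
    refine Integrable.of_bound (C := 1) (by fun_prop) (ae_of_all _ fun θ => ?_)
    rw [Real.norm_eq_abs, abs_mul, abs_pow]
    exact mul_le_one₀ (Real.abs_cos_le_one _) (by positivity)
      (pow_le_one₀ (abs_nonneg _) (abs_stepChar_le_one d θ))
  induction m generalizing a with
  | zero =>
    have := integral_cos_unitCube d (a - b)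
    simp only [Pi.sub_apply, sub_eq_zero] at this
    simp only [rwP, pow_zero, mul_one, this]
  | succ m ih =>
    simp only [rwP, ih]
    have hstep : ∀ θ : Fin d → ℝ,
        Real.cos (2 * π * ∑ i, θ i * ((a i - b i : ℤ) : ℝ)) * stepChar d θ ^ (m + 1) =
        (1 / (2 * d) : ℝ) * ∑ i : Fin d, ∑ s : Bool,
          Real.cos (2 * π * ∑ j, θ j * ((rwStep d i s a j - b j : ℤ) : ℝ)) * stepChar d θ ^ m := by
      intro θ
      rw [pow_succ', ← mul_assoc, ← sum_cos_rwStep, mul_assoc, Finset.sum_mul]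
      simp only [Finset.sum_mul]
    simp only [hstep]
    rw [integral_const_mul,
      integral_finsetSum _ fun i _ => integrable_finsetSum _ fun s _ => hInt m _]
    congr 1
    refine Finset.sum_congr rfl fun i _ => ?_
    rw [integral_finsetSum _ fun s _ => hInt m _]

lemma stepChar_sq_le (d : ℕ) (hd : 0 < d) (θ : Fin d → ℝ) :
    stepChar d θ ^ 2 ≤ ∏ i, Real.exp (-(1 / d) * Real.sin (2 * π * θ i) ^ 2) := by
  have hd' : (0 : ℝ) < d := Nat.cast_pos.2 hd
  have h1 : stepChar d θ ^ 2 ≤ (∑ i, Real.cos (2 * π * θ i) ^ 2) / d := by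
    have := sq_sum_le_card_mul_sum_sq (s := Finset.univ) (f := fun i => Real.cos (2 * π * θ i))
    simp only [Finset.card_univ, Fintype.card_fin] at this
    rw [stepChar, div_pow, div_le_div_iff₀ (by positivity) hd']
    nlinarith
  have h2 : (∑ i, Real.cos (2 * π * θ i) ^ 2) / d =
      -(∑ i, 1 / d * Real.sin (2 * π * θ i) ^ 2) + 1 := by
    simp only [Real.cos_sq', Finset.sum_sub_distrib, ← Finset.mul_sum]
    simp
    field_simp
    ring
  rw [← Real.exp_sum]
  simp only [neg_mul, Finset.sum_neg_distrib]
  exact h1.trans (h2 ▸ Real.add_one_le_exp _)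

lemma integral_exp_neg_sin_sq_le {c : ℝ} (hc : 0 < c) :
    ∫ t in Set.Ioc (0 : ℝ) 1, Real.exp (-c * Real.sin (2 * π * t) ^ 2) ≤ √(π / c) := by
  set f : ℝ → ℝ := fun t => Real.exp (-c * Real.sin (2 * π * t) ^ 2) with hf
  have hcont : Continuous f := by fun_prop
  have hper : Function.Periodic f (1 / 2) := by
    intro t
    simp only [hf]
    rw [show 2 * π * (t + 1 / 2) = 2 * π * t + π by ring, Real.sin_add_pi, neg_sq]
  have hquarter : ∀ t ∈ Set.Icc (-(1 / 4) : ℝ) (1 / 4), f t ≤ Real.exp (-(16 * c) * t ^ 2) := by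
    intro t ht
    have habs : |t| ≤ 1 / 4 := abs_le.2 ht
    have hj := Real.mul_abs_le_abs_sin (x := 2 * π * t) (by
      rw [abs_mul, abs_of_pos (by positivity)]; nlinarith [Real.pi_pos])
    rw [abs_mul, abs_of_pos (by positivity : (0 : ℝ) < 2 * π),
      show 2 / π * (2 * π * |t|) = 4 * |t| by field_simp; ring] at hj
    have hsq : (4 * |t|) ^ 2 ≤ |Real.sin (2 * π * t)| ^ 2 := by gcongr
    rw [mul_pow, sq_abs, sq_abs] at hsq
    simp only [hf]
    refine Real.exp_le_exp.2 ?_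
    nlinarith
  have hhalf : ∫ t in (-(1 / 4) : ℝ)..(1 / 4), f t ≤ √(π / (16 * c)) := by
    rw [← integral_gaussian]
    calc ∫ t in (-(1 / 4) : ℝ)..(1 / 4), f t
        ≤ ∫ t in (-(1 / 4) : ℝ)..(1 / 4), Real.exp (-(16 * c) * t ^ 2) :=
          intervalIntegral.integral_mono_on (by norm_num) (hcont.intervalIntegrable _ _)
            (Continuous.intervalIntegrable (by fun_prop) _ _) hquarter
      _ ≤ _ := by
          rw [intervalIntegral.integral_of_le (by norm_num)]
          exact setIntegral_le_integral (integrable_exp_neg_mul_sq (by positivity))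
            (ae_of_all _ fun t => (Real.exp_pos _).le)
  have h1 : ∫ t in (0 : ℝ)..(1 / 2), f t = ∫ t in (-(1 / 4) : ℝ)..(1 / 4), f t := by
    have := hper.intervalIntegral_add_eq 0 (-(1 / 4))
    norm_num at this ⊢
    exact this
  have h2 : ∫ t in (1 / 2 : ℝ)..1, f t = ∫ t in (-(1 / 4) : ℝ)..(1 / 4), f t := by
    have := hper.intervalIntegral_add_eq (1 / 2) (-(1 / 4))
    norm_num at this ⊢
    exact this
  rw [← intervalIntegral.integral_of_le zero_le_one,
    ← intervalIntegral.integral_add_adjacent_intervals (b := 1 / 2)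
      (hcont.intervalIntegrable _ _) (hcont.intervalIntegrable _ _), h1, h2]
  have h3 : √(π / (16 * c)) = √(π / c) / 4 := by
    rw [show π / (16 * c) = π / c / 4 ^ 2 by field_simp; norm_num, Real.sqrt_div (by positivity),
      Real.sqrt_sq (by norm_num)]
  have := Real.sqrt_nonneg (π / c)
  linarith

/-- On-diagonal heat kernel bound. -/
lemma abs_rwP_le (d : ℕ) (hd : 0 < d) (m : ℕ) (hm : 0 < m) (a b : Zd d) :
    |rwP d m a b| ≤ √(2 * π * d / m) ^ d := by
  have hd' : (0 : ℝ) < d := Nat.cast_pos.2 hd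
  have hm' : (0 : ℝ) < m := Nat.cast_pos.2 hm
  have hbd : ∀ θ : Fin d → ℝ, |stepChar d θ| ^ m ≤
      ∏ i, Real.exp (-(m / (2 * d)) * Real.sin (2 * π * θ i) ^ 2) := by
    intro θ
    have h := Real.sqrt_le_sqrt (stepChar_sq_le d hd θ)
    rw [Real.sqrt_sq_eq_abs, ← Real.exp_sum, Real.sqrt_eq_rpow, ← Real.exp_mul] at h
    refine (pow_le_pow_left₀ (abs_nonneg _) h m).trans_eq ?_
    rw [← Real.exp_nat_mul, ← Real.exp_sum, Finset.sum_mul, Finset.mul_sum]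
    congr 1
    refine Finset.sum_congr rfl fun i _ => ?_
    field_simp
  rw [rwP_eq_integral, ← Real.norm_eq_abs]
  calc ‖∫ θ, Real.cos (2 * π * ∑ i, θ i * ((a i - b i : ℤ) : ℝ)) * stepChar d θ ^ m
        ∂unitCubeMeasure d‖
      ≤ ∫ θ, ∏ i, Real.exp (-(m / (2 * d)) * Real.sin (2 * π * θ i) ^ 2) ∂unitCubeMeasure d := by
        refine norm_integral_le_of_norm_le ?_ (ae_of_all _ fun θ => ?_)
        · refine Integrable.of_bound (C := 1)
            (Continuous.aestronglyMeasurable (by fun_prop)) (ae_of_all _ fun θ => ?_)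
          rw [← Real.exp_sum, Real.norm_eq_abs, abs_of_pos (Real.exp_pos _), Real.exp_le_one_iff]
          refine Finset.sum_nonpos fun i _ => ?_
          have : 0 ≤ m / (2 * d) * Real.sin (2 * π * θ i) ^ 2 := by positivity
          linarith
        · rw [Real.norm_eq_abs, abs_mul, abs_pow]
          exact (mul_le_of_le_one_left (by positivity) (Real.abs_cos_le_one _)).trans (hbd θ)
    _ = (∫ t in Set.Ioc (0 : ℝ) 1,
          Real.exp (-(m / (2 * d)) * Real.sin (2 * π * t) ^ 2)) ^ d := by
        rw [unitCubeMeasure, integral_fintype_prod_eq_pow (ι := Fin d)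
          (fun t : ℝ => Real.exp (-(m / (2 * d)) * Real.sin (2 * π * t) ^ 2)), Fintype.card_fin]
    _ ≤ _ := by
        refine pow_le_pow_left₀ (integral_nonneg fun t => (Real.exp_pos _).le)
          ((integral_exp_neg_sin_sq_le (by positivity)).trans_eq ?_) d
        congr 1
        field_simp

lemma rwP_nonneg (d m : ℕ) (a b : Zd d) : 0 ≤ rwP d m a b := by
  induction m generalizing a with
  | zero => unfold rwP; positivity
  | succ m ih =>
    unfold rwP
    exact mul_nonneg (by positivity)
      (Finset.sum_nonneg fun i _ => Finset.sum_nonneg fun s _ => ih _)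

lemma rwP_self_eq (d m : ℕ) (a : Zd d) : rwP d m a a = rwP d m 0 0 := by
  simp [rwP_eq_integral]

lemma summable_rpow_mul_rwP (d : ℕ) (hd : 3 ≤ d) :
    Summable fun m : ℕ => (m : ℝ) ^ (1 / 4 : ℝ) * rwP d m 0 0 := by
  have hsum : Summable fun m : ℕ => √(2 * π * d) ^ d * (1 / (m : ℝ) ^ (5 / 4 : ℝ)) :=
    (Real.summable_one_div_nat_rpow.2 (by norm_num)).mul_left _
  refine Summable.of_nonneg_of_le
    (fun m => mul_nonneg (by positivity) (rwP_nonneg d m 0 0)) (fun m => ?_) hsum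
  rcases Nat.eq_zero_or_pos m with rfl | hm
  · norm_num
  have hm1 : (1 : ℝ) ≤ m := by exact_mod_cast hm
  have hm0 : (0 : ℝ) < m := by linarith
  have hb := (le_abs_self _).trans (abs_rwP_le d (by omega) m hm 0 0)
  have hpow : √(1 / (m : ℝ)) ^ d ≤ (m : ℝ) ^ (-(3 / 2) : ℝ) := by
    calc √(1 / (m : ℝ)) ^ d ≤ √(1 / (m : ℝ)) ^ 3 :=
          pow_le_pow_of_le_one (Real.sqrt_nonneg _)
            (Real.sqrt_le_one.2 ((div_le_one hm0).2 hm1)) hd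
      _ = (m : ℝ) ^ (-(3 / 2) : ℝ) := by
          rw [Real.sqrt_eq_rpow, one_div, Real.inv_rpow hm0.le, ← Real.rpow_neg hm0.le,
            ← Real.rpow_mul_natCast hm0.le]
          norm_num
  calc (m : ℝ) ^ (1 / 4 : ℝ) * rwP d m 0 0
      ≤ (m : ℝ) ^ (1 / 4 : ℝ) * (√(2 * π * d) ^ d * (m : ℝ) ^ (-(3 / 2) : ℝ)) := by
        gcongr
        refine hb.trans ?_
        rw [div_eq_mul_one_div, Real.sqrt_mul (by positivity), mul_pow]
        gcongr
    _ = √(2 * π * d) ^ d * (1 / (m : ℝ) ^ (5 / 4 : ℝ)) := by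
        rw [mul_left_comm, ← Real.rpow_add hm0, one_div ((m : ℝ) ^ _), ← Real.rpow_neg hm0.le]
        norm_num

lemma summable_rwP (d : ℕ) (hd : 3 ≤ d) : Summable fun m => rwP d m 0 0 := by
  rw [← summable_nat_add_iff 1]
  refine Summable.of_nonneg_of_le (fun m => rwP_nonneg _ _ _ _) (fun m => ?_)
    ((summable_nat_add_iff 1).2 (summable_rpow_mul_rwP d hd))
  refine le_mul_of_one_le_left (rwP_nonneg _ _ _ _) (Real.one_le_rpow ?_ (by norm_num))
  push_cast
  linarith [(Nat.cast_nonneg m : (0 : ℝ) ≤ m)]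

/-- Expected number of visits to the starting point up to time `k`. -/
noncomputable def truncatedGreen (d k : ℕ) : ℝ := ∑ m ∈ Finset.range (k + 1), rwP d m 0 0

lemma one_le_truncatedGreen (d k : ℕ) : 1 ≤ truncatedGreen d k := by
  unfold truncatedGreen
  rw [Finset.sum_range_succ']
  have : 0 ≤ ∑ m ∈ Finset.range k, rwP d (m + 1) 0 0 :=
    Finset.sum_nonneg fun _ _ => rwP_nonneg _ _ _ _
  simpa [rwP] using this

lemma truncatedGreen_le_green (d k : ℕ) (hd : 3 ≤ d) : truncatedGreen d k ≤ green d 0 0 :=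
  (summable_rwP d hd).sum_le_tsum _ fun _ _ => rwP_nonneg _ _ _ _

lemma green_sub_truncatedGreen_le (d k : ℕ) (hd : 3 ≤ d) :
    green d 0 0 - truncatedGreen d k ≤
      (∑' m : ℕ, (m : ℝ) ^ (1 / 4 : ℝ) * rwP d m 0 0) * ((k : ℝ) + 1) ^ (-(1 / 4) : ℝ) := by
  have hw := summable_rpow_mul_rwP d hd
  have hk : (0 : ℝ) < (k : ℝ) + 1 := by positivity
  have hsplit := (summable_rwP d hd).sum_add_tsum_nat_add (k + 1)
  have htail : ∑' m, rwP d (m + (k + 1)) 0 0 ≤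
      ∑' m : ℕ, ((k : ℝ) + 1) ^ (-(1 / 4) : ℝ) *
        (((m + (k + 1) : ℕ) : ℝ) ^ (1 / 4 : ℝ) * rwP d (m + (k + 1)) 0 0) := by
    refine ((summable_nat_add_iff (k + 1)).2 (summable_rwP d hd)).tsum_le_tsum (fun m => ?_)
      (((summable_nat_add_iff (k + 1)).2 hw).mul_left _)
    rw [← mul_assoc]
    refine le_mul_of_one_le_left (rwP_nonneg _ _ _ _) ?_
    rw [Real.rpow_neg hk.le, inv_mul_eq_div, one_le_div (by positivity)]
    refine Real.rpow_le_rpow hk.le ?_ (by norm_num)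
    push_cast
    linarith [(Nat.cast_nonneg m : (0 : ℝ) ≤ m)]
  have hle : ∑' m : ℕ, (((m + (k + 1) : ℕ) : ℝ) ^ (1 / 4 : ℝ) * rwP d (m + (k + 1)) 0 0) ≤
      ∑' m : ℕ, (m : ℝ) ^ (1 / 4 : ℝ) * rwP d m 0 0 := by
    rw [← hw.sum_add_tsum_nat_add (k + 1)]
    exact le_add_of_nonneg_left (Finset.sum_nonneg fun _ _ =>
      mul_nonneg (by positivity) (rwP_nonneg _ _ _ _))
  rw [tsum_mul_left] at htail
  have : green d 0 0 - truncatedGreen d k = ∑' m, rwP d (m + (k + 1)) 0 0 := by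
    rw [green, truncatedGreen]; linarith
  rw [this, mul_comm]
  exact htail.trans (by gcongr)

lemma rwPIn_nonneg (d : ℕ) (Λ : Set (Zd d)) (m : ℕ) (a b : Zd d) : 0 ≤ rwPIn d Λ m a b := by
  induction m generalizing a with
  | zero => unfold rwPIn; positivity
  | succ m ih =>
    unfold rwPIn
    split_ifs
    · exact mul_nonneg (by positivity)
        (Finset.sum_nonneg fun i _ => Finset.sum_nonneg fun s _ => ih _)
    · exact le_rfl

lemma rwPIn_le_rwP (d : ℕ) (Λ : Set (Zd d)) (m : ℕ) (a b : Zd d) :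
    rwPIn d Λ m a b ≤ rwP d m a b := by
  induction m generalizing a with
  | zero =>
    unfold rwPIn rwP
    by_cases h : a = b
    · by_cases h' : a ∈ Λ <;> simp [h] <;> split_ifs <;> norm_num
    · simp [h]
  | succ m ih =>
    have h := rwP_nonneg d (m + 1) a b
    unfold rwPIn
    split_ifs
    · unfold rwP
      gcongr
      exact ih _
    · exact h

lemma rwPIn_eq_rwP (d : ℕ) (Λ : Set (Zd d)) (m : ℕ) (a b : Zd d)
    (h : ∀ c : Zd d, (∀ i, |c i - a i| ≤ m) → c ∈ Λ) : rwPIn d Λ m a b = rwP d m a b := by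
  induction m generalizing a with
  | zero => simp [rwPIn, rwP, h a (by simp)]
  | succ m ih =>
    have ha : a ∈ Λ := h a fun i => by simp; positivity
    simp only [rwPIn, rwP, ha, if_true]
    congr 1
    refine Finset.sum_congr rfl fun i _ => Finset.sum_congr rfl fun s _ => ih _ fun c hc => ?_
    refine h c fun j => ?_
    have hstep : |rwStep d i s a j - a j| ≤ 1 := by
      by_cases hj : j = i
      · subst hj
        cases s <;> simp [rwStep]
      · simp [rwStep, hj]
    have := abs_sub_le (c j) (rwStep d i s a j) (a j)
    have := hc j
    push_cast
    linarith

lemma summable_rwPIn_self (d : ℕ) (hd : 3 ≤ d) (Λ : Set (Zd d)) (a : Zd d) :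
    Summable fun m => rwPIn d Λ m a a :=
  Summable.of_nonneg_of_le (fun _ => rwPIn_nonneg _ _ _ _ _)
    (fun m => (rwPIn_le_rwP _ _ _ _ _).trans_eq (rwP_self_eq d m a)) (summable_rwP d hd)

lemma greenIn_self_le_green (d : ℕ) (hd : 3 ≤ d) (Λ : Set (Zd d)) (a : Zd d) :
    greenIn d Λ a a ≤ green d 0 0 :=
  (summable_rwPIn_self d hd Λ a).tsum_le_tsum
    (fun m => (rwPIn_le_rwP _ _ _ _ _).trans_eq (rwP_self_eq d m a)) (summable_rwP d hd)

lemma truncatedGreen_le_greenIn_self (d : ℕ) (hd : 3 ≤ d) (Λ : Set (Zd d)) (a : Zd d) (k : ℕ)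
    (h : ∀ c : Zd d, (∀ i, |c i - a i| ≤ k) → c ∈ Λ) :
    truncatedGreen d k ≤ greenIn d Λ a a := by
  refine le_trans (Finset.sum_le_sum fun m hm => ?_)
    ((summable_rwPIn_self d hd Λ a).sum_le_tsum (Finset.range (k + 1))
      fun _ _ => rwPIn_nonneg _ _ _ _ _)
  have hmk : (m : ℤ) ≤ k := by exact_mod_cast Nat.lt_succ_iff.1 (Finset.mem_range.1 hm)
  rw [rwPIn_eq_rwP d Λ m a a fun c hc => h c fun i => (hc i).trans hmk, rwP_self_eq d m a]

lemma greenIn_self_pos (d : ℕ) (hd : 3 ≤ d) (Λ : Set (Zd d)) (a : Zd d) (ha : a ∈ Λ) :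
    0 < greenIn d Λ a a := by
  refine zero_lt_one.trans_le ((one_le_truncatedGreen d 0).trans
    (truncatedGreen_le_greenIn_self d hd Λ a 0 fun c hc => ?_))
  have : c = a := funext fun i => by simpa [sub_eq_zero] using hc i
  exact this ▸ ha

/-- Upper tail of the standard normal distribution. -/
noncomputable def normalTail (t : ℝ) : ℝ := (gaussianReal 0 1).real (Set.Ioi t)

lemma normalTail_nonneg (t : ℝ) : 0 ≤ normalTail t := measureReal_nonneg

lemma normalTail_antitone : Antitone normalTail := fun _ _ h =>
  measureReal_mono (Set.Ioi_subset_Ioi h)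

lemma normalTail_eq_integral (t : ℝ) :
    normalTail t = ∫ s in Set.Ioi t, gaussianPDFReal 0 1 s := by
  rw [normalTail, measureReal_def, gaussianReal_apply_eq_integral 0 one_ne_zero,
    ENNReal.toReal_ofReal (integral_nonneg fun s => gaussianPDFReal_nonneg 0 1 s)]

lemma gaussianReal_Ioi {v : ℝ} (hv : 0 < v) (u : ℝ) :
    (gaussianReal 0 v.toNNReal).real (Set.Ioi u) = normalTail (u / √v) := by
  have h := gaussianReal_map_const_mul (μ := 0) (v := 1) (√v)
  have hmk : (NNReal.mk (√v ^ 2) (sq_nonneg _) * 1 : NNReal) = v.toNNReal := by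
    ext
    simp [Real.sq_sqrt hv.le, hv.le]
  rw [mul_zero, hmk] at h
  rw [← h, normalTail, map_measureReal_apply (by fun_prop) measurableSet_Ioi]
  congr 1
  ext z
  simp [div_lt_iff₀' (Real.sqrt_pos.2 hv)]

lemma gaussianPDFReal_zero_one (t : ℝ) :
    gaussianPDFReal 0 1 t = (√(2 * π))⁻¹ * Real.exp (-t ^ 2 / 2) := by
  simp [gaussianPDFReal]

lemma hasDerivAt_gaussianPDFReal_zero_one (t : ℝ) :
    HasDerivAt (gaussianPDFReal 0 1) (-(t * gaussianPDFReal 0 1 t)) t := by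
  have h : HasDerivAt (fun s : ℝ => (√(2 * π))⁻¹ * Real.exp (-s ^ 2 / 2))
      ((√(2 * π))⁻¹ * (Real.exp (-t ^ 2 / 2) * (-(2 * t) / 2))) t := by
    have h2 : HasDerivAt (fun s : ℝ => -s ^ 2 / 2) (-(2 * t) / 2) t := by
      simpa using ((hasDerivAt_pow 2 t).neg.div_const 2)
    exact (h2.exp).const_mul _
  rw [show gaussianPDFReal 0 1 = fun s : ℝ => (√(2 * π))⁻¹ * Real.exp (-s ^ 2 / 2) from
    funext gaussianPDFReal_zero_one]
  convert! h using 1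
  ring

lemma tendsto_gaussianPDFReal_zero_one : Tendsto (gaussianPDFReal 0 1) atTop (nhds 0) := by
  have h : Tendsto (fun t : ℝ => (√(2 * π))⁻¹ * Real.exp (-t ^ 2 / 2)) atTop
      (nhds ((√(2 * π))⁻¹ * 0)) := by
    refine (Real.tendsto_exp_atBot.comp ?_).const_mul _
    simp only [neg_div]
    exact tendsto_neg_atTop_atBot.comp ((tendsto_pow_atTop two_ne_zero).atTop_div_const two_pos)
  rw [mul_zero] at h
  exact h.congr fun t => (gaussianPDFReal_zero_one t).symm

lemma mul_normalTail_le {t : ℝ} (ht : 0 < t) : t * normalTail t ≤ gaussianPDFReal 0 1 t := by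
  have hd : ∀ s ∈ Set.Ici t, HasDerivAt (fun r => -gaussianPDFReal 0 1 r)
      (s * gaussianPDFReal 0 1 s) s := fun s _ => by
    convert! (hasDerivAt_gaussianPDFReal_zero_one s).neg using 1
    ring
  have hnn : ∀ s ∈ Set.Ioi t, 0 ≤ s * gaussianPDFReal 0 1 s := fun s hs =>
    mul_nonneg (ht.trans hs).le (gaussianPDFReal_nonneg _ _ _)
  have hlim : Tendsto (fun r => -gaussianPDFReal 0 1 r) atTop (nhds 0) := by
    simpa using tendsto_gaussianPDFReal_zero_one.neg
  have hI := integral_Ioi_of_hasDerivAt_of_nonneg' hd hnn hlim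
  rw [zero_sub, neg_neg] at hI
  rw [← hI, normalTail_eq_integral, ← integral_const_mul]
  exact setIntegral_mono_on ((integrable_gaussianPDFReal 0 1).integrableOn.const_mul t)
    (integrableOn_Ioi_deriv_of_nonneg' hd hnn hlim) measurableSet_Ioi fun s hs =>
      mul_le_mul_of_nonneg_right (le_of_lt hs) (gaussianPDFReal_nonneg _ _ _)

lemma gaussianPDFReal_le_mul_normalTail {t : ℝ} (ht : 0 < t) :
    gaussianPDFReal 0 1 t / t ≤ (1 + 1 / t ^ 2) * normalTail t := by
  have hd : ∀ s ∈ Set.Ici t, HasDerivAt (fun r => -(gaussianPDFReal 0 1 r / r))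
      ((1 + 1 / s ^ 2) * gaussianPDFReal 0 1 s) s := fun s hs => by
    have hs0 : s ≠ 0 := (ht.trans_le hs).ne'
    convert! ((hasDerivAt_gaussianPDFReal_zero_one s).div (hasDerivAt_id s) hs0).neg using 1
    simp only [id]
    field_simp
    ring
  have hnn : ∀ s ∈ Set.Ioi t, 0 ≤ (1 + 1 / s ^ 2) * gaussianPDFReal 0 1 s := fun s hs =>
    mul_nonneg (by positivity) (gaussianPDFReal_nonneg _ _ _)
  have hlim : Tendsto (fun r => -(gaussianPDFReal 0 1 r / r)) atTop (nhds 0) := by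
    simpa using (tendsto_gaussianPDFReal_zero_one.div_atTop tendsto_id).neg
  have hI := integral_Ioi_of_hasDerivAt_of_nonneg' hd hnn hlim
  rw [zero_sub, neg_neg] at hI
  rw [← hI, normalTail_eq_integral, ← integral_const_mul]
  refine setIntegral_mono_on (integrableOn_Ioi_deriv_of_nonneg' hd hnn hlim)
    ((integrable_gaussianPDFReal 0 1).integrableOn.const_mul _) measurableSet_Ioi fun s hs =>
      mul_le_mul_of_nonneg_right ?_ (gaussianPDFReal_nonneg _ _ _)
  have : t ≤ s := le_of_lt hs
  gcongr

/-- The Mills ratio asymptotics for the normal tail. -/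
lemma tendsto_mills_ratio :
    Tendsto (fun t => normalTail t / (gaussianPDFReal 0 1 t / t)) atTop (nhds 1) := by
  have hlow : Tendsto (fun t : ℝ => (1 + 1 / t ^ 2)⁻¹) atTop (nhds 1) := by
    have h : Tendsto (fun t : ℝ => 1 + 1 / t ^ 2) atTop (nhds (1 + 0)) :=
      tendsto_const_nhds.add (tendsto_const_nhds.div_atTop (tendsto_pow_atTop two_ne_zero))
    simpa using h.inv₀ (by norm_num)
  refine tendsto_of_tendsto_of_tendsto_of_le_of_le' hlow tendsto_const_nhds ?_ ?_
  · filter_upwards [eventually_gt_atTop 0] with t ht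
    have hp : 0 < gaussianPDFReal 0 1 t / t := div_pos (gaussianPDFReal_pos _ _ _ one_ne_zero) ht
    rw [le_div_iff₀ hp, inv_mul_le_iff₀ (by positivity)]
    exact gaussianPDFReal_le_mul_normalTail ht
  · filter_upwards [eventually_gt_atTop 0] with t ht
    have hp : 0 < gaussianPDFReal 0 1 t / t := div_pos (gaussianPDFReal_pos _ _ _ one_ne_zero) ht
    rw [div_le_one hp, le_div_iff₀ ht, mul_comm]
    exact mul_normalTail_le ht

/-- If `t n ^ 2 / 2 = L n - (log (L n) + log (4 * π)) / 2 + x + o(1)`, then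
`exp (L n) * normalTail (t n)` converges to `exp (-x)`. -/
lemma tendsto_exp_mul_normalTail {L t : ℕ → ℝ} {x : ℝ} (hL : Tendsto L atTop atTop)
    (ht : Tendsto t atTop atTop) (hst : Tendsto (fun n => √(2 * L n) / t n) atTop (nhds 1))
    (hE : Tendsto (fun n => L n - (Real.log (L n) + Real.log (4 * π)) / 2 - t n ^ 2 / 2)
      atTop (nhds (-x))) :
    Tendsto (fun n => Real.exp (L n) * normalTail (t n)) atTop (nhds (Real.exp (-x))) := by
  have h := ((tendsto_mills_ratio.comp ht).mul hst).mul ((Real.continuous_exp.tendsto _).comp hE)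
  rw [one_mul, one_mul] at h
  refine h.congr' ?_
  filter_upwards [hL.eventually_gt_atTop 0, ht.eventually_gt_atTop 0] with n hLn htn
  have h2 : Real.exp ((Real.log (L n) + Real.log (4 * π)) / 2) = √(2 * L n) * √(2 * π) := by
    rw [← Real.log_mul hLn.ne' (by positivity), ← Real.sqrt_mul (by positivity),
      ← Real.exp_log (Real.sqrt_pos.2 (by positivity : 0 < 2 * L n * (2 * π))),
      Real.log_sqrt (by positivity)]
    ring_nf
  have hs : 0 < √(2 * L n) := Real.sqrt_pos.2 (by positivity)
  have hp : 0 < √(2 * π) := Real.sqrt_pos.2 (by positivity)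
  simp only [Function.comp_apply, gaussianPDFReal_zero_one]
  rw [show L n - (Real.log (L n) + Real.log (4 * π)) / 2 - t n ^ 2 / 2 =
    L n + -t n ^ 2 / 2 - (Real.log (L n) + Real.log (4 * π)) / 2 by ring, Real.exp_sub,
    Real.exp_add, h2]
  field_simp

lemma uN_eq {g : ℝ} (hg : 0 < g) (N : ℕ) (x : ℝ) :
    uN g N x = √g * ((√(2 * Real.log N) -
      (Real.log (Real.log N) + Real.log (4 * π)) / (2 * √(2 * Real.log N))) +
      x / (√(2 * Real.log N) -
        (Real.log (Real.log N) + Real.log (4 * π)) / (2 * √(2 * Real.log N)))) := by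
  have hs : √g * √g = g := Real.mul_self_sqrt hg.le
  have hs0 : √g ≠ 0 := (Real.sqrt_pos.2 hg).ne'
  rw [uN, aN, bN, mul_add, add_comm]
  congr 1
  nth_rewrite 1 [← hs]
  rw [mul_div_mul_left _ _ hs0]
  ring

lemma tendsto_mul_normalTail_uN {g : ℝ} (hg : 0 < g) {N : ℕ → ℕ} (hN : Tendsto N atTop atTop)
    {v : ℕ → ℝ} (hv : ∀ n, 0 < v n)
    (hgv : Tendsto (fun n => (g - v n) * Real.log (N n)) atTop (nhds 0)) (x : ℝ) :
    Tendsto (fun n => uN g (N n) x / √(v n)) atTop atTop ∧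
    Tendsto (fun n => (N n : ℝ) * normalTail (uN g (N n) x / √(v n))) atTop
      (nhds (Real.exp (-x))) := by
  set L : ℕ → ℝ := fun n => Real.log (N n) with hLdef
  have hL : Tendsto L atTop atTop :=
    Real.tendsto_log_atTop.comp (tendsto_natCast_atTop_atTop.comp hN)
  set s : ℕ → ℝ := fun n => √(2 * L n) with hsdef
  have hs : Tendsto s atTop atTop :=
    Real.tendsto_sqrt_atTop.comp (hL.const_mul_atTop two_pos)
  set h : ℕ → ℝ := fun n => (Real.log (L n) + Real.log (4 * π)) / (2 * s n) with hhdef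
  have hh : Tendsto h atTop (nhds 0) := by
    have h1 : Tendsto (fun y : ℝ => Real.log y / √y) atTop (nhds 0) := by
      have := (isLittleO_log_rpow_atTop (by norm_num : (0 : ℝ) < 1 / 2)).tendsto_div_nhds_zero
      simpa only [Real.sqrt_eq_rpow] using this
    have h2 := ((h1.comp hL).mul_const ((2 * √2)⁻¹)).add
      ((tendsto_const_nhds (x := Real.log (4 * π))).div_atTop (hs.const_mul_atTop two_pos))
    rw [zero_mul, zero_add] at h2
    refine h2.congr' ?_
    filter_upwards with n
    simp only [hhdef, hsdef, Function.comp_apply, add_div]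
    rw [Real.sqrt_mul zero_le_two, div_mul_eq_mul_div, ← div_eq_mul_inv, div_div]
    congr 2
    ring
  set β : ℕ → ℝ := fun n => s n - h n with hβdef
  have hβ : Tendsto β atTop atTop := by
    simpa only [hβdef, sub_eq_add_neg] using hs.atTop_add hh.neg
  set τ : ℕ → ℝ := fun n => β n + x / β n with hτdef
  have hxβ : Tendsto (fun n => x / β n) atTop (nhds 0) := tendsto_const_nhds.div_atTop hβ
  have hu : ∀ n, uN g (N n) x = √g * τ n := fun n => uN_eq hg (N n) x
  have hvg : Tendsto v atTop (nhds g) := by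
    have h1 : Tendsto (fun n => (g - v n) * L n / L n) atTop (nhds 0) := hgv.div_atTop hL
    have h2 : Tendsto (fun n => g - (g - v n) * L n / L n) atTop (nhds (g - 0)) :=
      tendsto_const_nhds.sub h1
    rw [sub_zero] at h2
    refine h2.congr' ?_
    filter_upwards [hL.eventually_gt_atTop 0] with n hn
    field_simp
    ring
  have hratio : Tendsto (fun n => √g / √(v n)) atTop (nhds 1) := by
    have h1 : Tendsto (fun n => √g / √(v n)) atTop (nhds (√g / √g)) :=
      tendsto_const_nhds.div ((Real.continuous_sqrt.tendsto g).comp hvg) (Real.sqrt_pos.2 hg).ne'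
    rwa [div_self (Real.sqrt_pos.2 hg).ne'] at h1
  have hτ : Tendsto τ atTop atTop := hβ.atTop_add hxβ
  have hτs : Tendsto (fun n => τ n / s n) atTop (nhds 1) := by
    have h1 : Tendsto (fun n => 1 - h n / s n + x / β n / s n) atTop (nhds (1 - 0 + 0)) :=
      (tendsto_const_nhds.sub (hh.div_atTop hs)).add (hxβ.div_atTop hs)
    rw [sub_zero, add_zero] at h1
    refine h1.congr' ?_
    filter_upwards [hs.eventually_gt_atTop 0] with n hn
    simp only [hτdef, hβdef]
    rw [add_div, sub_div, div_self hn.ne']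
  have htdef : ∀ n, uN g (N n) x / √(v n) = √g / √(v n) * τ n := fun n => by
    rw [hu n]; ring
  have ht : Tendsto (fun n => uN g (N n) x / √(v n)) atTop atTop := by
    simp only [htdef]
    exact hratio.pos_mul_atTop one_pos hτ
  refine ⟨ht, ?_⟩
  have hmain := tendsto_exp_mul_normalTail (x := x) hL ht ?_ ?_
  · refine hmain.congr' ?_
    filter_upwards [hN.eventually_gt_atTop 0] with n hn
    simp only [hLdef]
    rw [Real.exp_log (Nat.cast_pos.2 hn)]
  · have h1 := (hratio.mul hτs).inv₀ (by norm_num)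
    rw [one_mul, inv_one] at h1
    refine h1.congr fun n => ?_
    rw [htdef n, ← mul_div_assoc, inv_div]
  · have hlim : Tendsto (fun n => -(h n) ^ 2 / 2 - x - (x / β n) ^ 2 / 2 -
        (τ n / s n) ^ 2 * ((g - v n) * L n) / v n) atTop
        (nhds (-0 ^ 2 / 2 - x - 0 ^ 2 / 2 - 1 ^ 2 * 0 / g)) :=
      (((((hh.pow 2).neg).div_const 2).sub_const x).sub ((hxβ.pow 2).div_const 2)).sub
        (((hτs.pow 2).mul hgv).div hvg hg.ne')
    norm_num at hlim
    refine hlim.congr' ?_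
    filter_upwards [hs.eventually_gt_atTop 0, hβ.eventually_gt_atTop 0,
      hL.eventually_gt_atTop 0] with n hsn hβn hLn
    have hs2 : s n ^ 2 = 2 * L n := Real.sq_sqrt (by positivity)
    have hsh : Real.log (L n) + Real.log (4 * π) = 2 * s n * h n := by
      simp only [hhdef]; field_simp
    have hτ2 : τ n ^ 2 = β n ^ 2 + 2 * x + (x / β n) ^ 2 := by
      simp only [hτdef]; field_simp; ring
    have ht2 : (√g / √(v n) * τ n) ^ 2 = τ n ^ 2 + τ n ^ 2 * (g - v n) / v n := by
      have := (hv n).ne'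
      rw [mul_pow, div_pow, Real.sq_sqrt hg.le, Real.sq_sqrt (hv n).le]
      field_simp
      ring
    have hterm : (τ n / s n) ^ 2 * ((g - v n) * L n) / v n = τ n ^ 2 * (g - v n) / v n / 2 := by
      rw [div_pow, hs2]; field_simp
    rw [htdef n, ht2, hterm, hsh, hτ2]
    simp only [hβdef]
    linear_combination (1 / 2 : ℝ) * hs2

/-- The points of `nA ∩ V_N` at distance more than `k` from the complement of `V_N`. -/
noncomputable def innerIdx (d n k : ℕ) (lo hi : Fin d → ℝ) : Finset (Zd d) :=
  Fintype.piFinset fun i =>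
    Finset.Icc (max (k : ℤ) (⌊lo i * n⌋ + 1)) (min ((n : ℤ) - 1 - k) ⌊hi i * n⌋)

lemma innerIdx_zero (d n : ℕ) (hn : 0 < n) (lo hi : Fin d → ℝ) :
    innerIdx d n 0 lo hi = rectIdx d n lo hi := by
  have hn' : (0 : ℝ) < n := Nat.cast_pos.2 hn
  ext a
  simp only [innerIdx, rectIdx, VN, rect, Fintype.mem_piFinset, Finset.mem_Icc, Finset.mem_filter,
    Set.mem_ofPred_eq, Set.mem_inter_iff, Set.mem_Icc, Set.mem_Ioc, ← forall_and]
  refine forall_congr' fun i => ?_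
  rw [max_le_iff, le_min_iff, Int.add_one_le_iff, Int.floor_lt, Int.le_floor, lt_div_iff₀ hn',
    div_le_iff₀ hn', div_le_iff₀ hn', one_mul]
  push_cast
  rw [sub_zero]
  constructor
  · rintro ⟨⟨h0, hl⟩, h1, hh⟩
    have h0' : (0 : ℝ) ≤ a i := by exact_mod_cast h0
    have h1' : ((a i : ℤ) : ℝ) ≤ n := by exact_mod_cast (by omega : a i ≤ n)
    exact ⟨⟨h0, h1⟩, ⟨by positivity, h1'⟩, hl, hh⟩
  · rintro ⟨⟨h0, h1⟩, -, hl, hh⟩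
    exact ⟨⟨h0, hl⟩, h1, hh⟩

lemma innerIdx_subset (d n k : ℕ) (lo hi : Fin d → ℝ) :
    innerIdx d n k lo hi ⊆ innerIdx d n 0 lo hi := by
  refine Fintype.piFinset_subset _ _ fun i => Finset.Icc_subset_Icc ?_ ?_
  · exact max_le_max_right _ (by simp)
  · exact min_le_min_right _ (by omega)

lemma mem_VN_of_mem_innerIdx {d n k : ℕ} {lo hi : Fin d → ℝ} {a c : Zd d}
    (ha : a ∈ innerIdx d n k lo hi) (hc : ∀ i, |c i - a i| ≤ k) : c ∈ VN d n := by
  simp only [innerIdx, VN, Fintype.mem_piFinset, Finset.mem_Icc] at ha ⊢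
  intro i
  have h1 := ha i
  have h2 := abs_le.1 (hc i)
  omega

lemma tendsto_card_innerIdx (d : ℕ) (lo hi : Fin d → ℝ) {k : ℕ → ℕ}
    (hk : Tendsto (fun n : ℕ => (k n : ℝ) / n) atTop (nhds 0)) :
    Tendsto (fun n : ℕ => ((innerIdx d n (k n) lo hi).card : ℝ) / (n ^ d : ℕ)) atTop
      (nhds (∏ i, max 0 (min 1 (hi i) - max 0 (lo i)))) := by
  have hfloor : ∀ c : ℝ, Tendsto (fun n : ℕ => (⌊c * n⌋ : ℝ) / n) atTop (nhds c) := by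
    intro c
    have hone : Tendsto (fun n : ℕ => c - 1 / (n : ℝ)) atTop (nhds (c - 0)) :=
      tendsto_const_nhds.sub tendsto_one_div_atTop_nhds_zero_nat
    rw [sub_zero] at hone
    refine tendsto_of_tendsto_of_tendsto_of_le_of_le' hone tendsto_const_nhds ?_ ?_
    · filter_upwards [eventually_gt_atTop 0] with n hn
      have hn' : (0 : ℝ) < n := Nat.cast_pos.2 hn
      rw [le_div_iff₀ hn', sub_mul, one_div_mul_cancel hn'.ne']
      exact (Int.sub_one_lt_floor _).le
    · filter_upwards [eventually_gt_atTop 0] with n hn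
      have hn' : (0 : ℝ) < n := Nat.cast_pos.2 hn
      rw [div_le_iff₀ hn']
      exact Int.floor_le _
  have hprod : Tendsto (fun n : ℕ => ∏ i, max 0
      (min (1 - 1 / (n : ℝ) - k n / n) (⌊hi i * n⌋ / n) + 1 / (n : ℝ) -
        max ((k n : ℝ) / n) (⌊lo i * n⌋ / n + 1 / (n : ℝ)))) atTop
      (nhds (∏ i, max 0 (min 1 (hi i) - max 0 (lo i)))) := by
    refine tendsto_finsetProd _ fun i _ => tendsto_const_nhds.max ?_
    have h1 := tendsto_one_div_atTop_nhds_zero_nat (𝕜 := ℝ)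
    have := (((((tendsto_const_nhds (x := (1 : ℝ))).sub h1).sub hk).min (hfloor (hi i))).add
      h1).sub (hk.max ((hfloor (lo i)).add h1))
    simpa only [sub_zero, add_zero] using this
  refine hprod.congr' ?_
  filter_upwards [eventually_gt_atTop 0] with n hn
  have hn' : (0 : ℝ) < n := Nat.cast_pos.2 hn
  rw [innerIdx, Fintype.card_piFinset]
  push_cast
  rw [← Fin.prod_const d (n : ℝ), ← Finset.prod_div_distrib]
  refine Finset.prod_congr rfl fun i _ => ?_
  have hcard : ((Finset.Icc (max (k n : ℤ) (⌊lo i * n⌋ + 1))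
      (min ((n : ℤ) - 1 - k n) ⌊hi i * n⌋)).card : ℝ) =
      max 0 (min ((n : ℝ) - 1 - k n) ⌊hi i * n⌋ + 1 - max (k n : ℝ) (⌊lo i * n⌋ + 1)) := by
    rw [Int.card_Icc, max_comm (0 : ℝ)]
    exact_mod_cast congrArg (Int.cast (R := ℝ)) (Int.toNat_eq_max _)
  rw [hcard, ← max_div_div_right hn'.le, zero_div, sub_div, add_div, ← max_div_div_right hn'.le,
    ← min_div_div_right hn'.le, sub_div, sub_div, div_self hn'.ne', add_div]

lemma volume_rect_toReal (d : ℕ) (lo hi : Fin d → ℝ) :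
    (volume (rect d lo hi)).toReal = ∏ i, max 0 (min 1 (hi i) - max 0 (lo i)) := by
  have hpi : rect d lo hi = Set.pi Set.univ fun i => Set.Icc 0 1 ∩ Set.Ioc (lo i) (hi i) := by
    ext t; simp [rect]
  rw [hpi, volume_pi_pi, ENNReal.toReal_prod]
  refine Finset.prod_congr rfl fun i _ => ?_
  have hae : (Set.Icc (0 : ℝ) 1 ∩ Set.Ioc (lo i) (hi i) : Set ℝ) =ᵐ[volume]
      (Set.Ioc (0 : ℝ) 1 ∩ Set.Ioc (lo i) (hi i) : Set ℝ) :=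
    Ioc_ae_eq_Icc.symm.inter (ae_eq_refl _)
  rw [measure_congr hae, Set.Ioc_inter_Ioc, Real.volume_Ioc, ENNReal.toReal_ofReal', max_comm]

lemma tendsto_green_sub_truncatedGreen_mul_log (d : ℕ) (hd : 3 ≤ d) :
    Tendsto (fun n : ℕ => (green d 0 0 - truncatedGreen d n.sqrt) * Real.log (n ^ d : ℕ)) atTop
      (nhds 0) := by
  set S : ℝ := ∑' m : ℕ, (m : ℝ) ^ (1 / 4 : ℝ) * rwP d m 0 0
  have hS : 0 ≤ S := tsum_nonneg fun m => mul_nonneg (by positivity) (rwP_nonneg _ _ _ _)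
  have hlog : Tendsto (fun n : ℕ => S * d * (Real.log n / (n : ℝ) ^ (1 / 8 : ℝ))) atTop
      (nhds (S * d * 0)) :=
    (((isLittleO_log_rpow_atTop (by norm_num : (0 : ℝ) < 1 / 8)).tendsto_div_nhds_zero).comp
      tendsto_natCast_atTop_atTop).const_mul _
  rw [mul_zero] at hlog
  refine tendsto_of_tendsto_of_tendsto_of_le_of_le' tendsto_const_nhds hlog ?_ ?_
  · filter_upwards [eventually_gt_atTop 0] with n hn
    exact mul_nonneg (sub_nonneg.2 (truncatedGreen_le_green d _ hd)) (Real.log_natCast_nonneg _)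
  · filter_upwards [eventually_gt_atTop 0] with n hn
    have hn' : (0 : ℝ) < n := Nat.cast_pos.2 hn
    have hsqrt : (n : ℝ) ≤ ((n.sqrt : ℝ) + 1) ^ 2 := by
      have := (Nat.lt_succ_sqrt' n).le
      exact_mod_cast this
    have hpow : ((n.sqrt : ℝ) + 1) ^ (-(1 / 4) : ℝ) ≤ (n : ℝ) ^ (-(1 / 8) : ℝ) := by
      calc ((n.sqrt : ℝ) + 1) ^ (-(1 / 4) : ℝ) = (((n.sqrt : ℝ) + 1) ^ 2) ^ (-(1 / 8) : ℝ) := by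
            rw [← Real.rpow_natCast_mul (by positivity)]; norm_num
        _ ≤ _ := Real.rpow_le_rpow_of_nonpos hn' hsqrt (by norm_num)
    have hlog0 : 0 ≤ Real.log n := Real.log_natCast_nonneg n
    push_cast
    rw [Real.log_pow]
    calc (green d 0 0 - truncatedGreen d n.sqrt) * (d * Real.log n)
        ≤ (S * (n : ℝ) ^ (-(1 / 8) : ℝ)) * (d * Real.log n) := by
          gcongr
          exact (green_sub_truncatedGreen_le d _ hd).trans (by gcongr)
      _ = _ := by rw [Real.rpow_neg hn'.le]; field_simp

lemma tendsto_natSqrt_div : Tendsto (fun n : ℕ => (n.sqrt : ℝ) / n) atTop (nhds 0) := by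
  have h : Tendsto (fun n : ℕ => 1 / √(n : ℝ)) atTop (nhds 0) :=
    tendsto_const_nhds.div_atTop (Real.tendsto_sqrt_atTop.comp tendsto_natCast_atTop_atTop)
  refine squeeze_zero (fun n => by positivity) (fun n => ?_) h
  rw [← Real.sqrt_div_self']
  gcongr
  exact Real.nat_sqrt_le_real_sqrt

lemma tendsto_sum_normalTail (d : ℕ) (hd : 3 ≤ d) (lo hi : Fin d → ℝ) (x : ℝ) :
    Tendsto (fun n : ℕ => ∑ a ∈ rectIdx d n lo hi,
      normalTail (uN (green d 0 0) (n ^ d) x / √(greenIn d (VN d n : Set (Zd d)) a a)))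
      atTop (nhds ((volume (rect d lo hi)).toReal * Real.exp (-x))) := by
  have hg : 0 < green d 0 0 :=
    zero_lt_one.trans_le ((one_le_truncatedGreen d 0).trans (truncatedGreen_le_green d 0 hd))
  have hN : Tendsto (fun n : ℕ => n ^ d) atTop atTop := tendsto_pow_atTop (by omega)
  obtain ⟨hupos, hupper⟩ := tendsto_mul_normalTail_uN hg hN (v := fun _ => green d 0 0)
    (fun _ => hg) (by simp) x
  obtain ⟨-, hlower⟩ := tendsto_mul_normalTail_uN hg hN
    (v := fun n => truncatedGreen d n.sqrt)
    (fun n => zero_lt_one.trans_le (one_le_truncatedGreen d _))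
    (tendsto_green_sub_truncatedGreen_mul_log d hd) x
  have hcard0 := tendsto_card_innerIdx d lo hi (k := fun _ => 0) (by simp)
  have hcard := tendsto_card_innerIdx d lo hi tendsto_natSqrt_div
  rw [volume_rect_toReal]
  refine tendsto_of_tendsto_of_tendsto_of_le_of_le' (hcard.mul hlower) (hcard0.mul hupper) ?_ ?_
  all_goals
    filter_upwards [eventually_gt_atTop 0, hupos.eventually_gt_atTop 0] with n hn hu
    have hu0 : 0 < uN (green d 0 0) (n ^ d) x := (div_pos_iff_of_pos_right (Real.sqrt_pos.2 hg)).1 hu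
    have hnd : ((n ^ d : ℕ) : ℝ) ≠ 0 := by positivity
    rw [div_mul_eq_mul_div, mul_div_assoc, mul_div_cancel_left₀ _ hnd, ← nsmul_eq_mul]
  · rw [← innerIdx_zero d n hn]
    refine le_trans ?_ (Finset.sum_le_sum_of_subset_of_nonneg
      (innerIdx_subset d n n.sqrt lo hi) fun _ _ _ => normalTail_nonneg _)
    refine Finset.card_nsmul_le_sum _ _ _ fun a ha => normalTail_antitone ?_
    have h1 := one_le_truncatedGreen d n.sqrt
    have h2 := truncatedGreen_le_greenIn_self d hd (VN d n : Set (Zd d)) a n.sqrt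
      fun c hc => Finset.mem_coe.2 (mem_VN_of_mem_innerIdx ha hc)
    gcongr
  · rw [← innerIdx_zero d n hn]
    refine Finset.sum_le_card_nsmul _ _ _ fun a ha => normalTail_antitone ?_
    have h1 := greenIn_self_pos d hd (VN d n : Set (Zd d)) a
      (Finset.mem_coe.2 (mem_VN_of_mem_innerIdx ha fun i => by simp))
    have h2 := greenIn_self_le_green d hd (VN d n : Set (Zd d)) a
    gcongr

lemma IsGaussianField.map_eq {Ω : Type*} [MeasurableSpace Ω] {P : Measure Ω} {d : ℕ}
    {G : Zd d → Zd d → ℝ} {φ : Zd d → Ω → ℝ} (h : IsGaussianField P d G φ) (a : Zd d) :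
    Measure.map (φ a) P = gaussianReal 0 (G a a).toNNReal := by
  simpa [Finsupp.support_single] using h.2 (Finsupp.single a 1)

/-- For the zero-boundary DGFF on `V_N`: for every bounded rectangle
`A ⊆ [0,1]^d` and all `x < y ≤ +∞`, the sum over `α ∈ nA ∩ V_N` of
`P(u_N(x) < ψ_α ≤ u_N(y))` converges to `|A|(e^{-x} - e^{-y})`. -/
theorem extremal_mean_measure_finite_volume
    (d : ℕ) (hd : 3 ≤ d)
    {Ω : Type*} [MeasurableSpace Ω] (P : Measure Ω) [IsProbabilityMeasure P]
    (ψ : (n : ℕ) → Zd d → Ω → ℝ)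
    (hψ : ∀ n, IsGaussianField P d (greenIn d (VN d n : Set (Zd d))) (ψ n))
    (hψ0 : ∀ n, ∀ a ∉ VN d n, ∀ᵐ ω ∂P, ψ n a ω = 0)
    (lo hi : Fin d → ℝ) (hlohi : ∀ i, lo i < hi i)
    (x : ℝ) (y : EReal) (hxy : (x : EReal) < y) :
    Tendsto
      (fun n : ℕ =>
        ∑ a ∈ rectIdx d n lo hi,
          (P {ω | (uN (green d 0 0) (n ^ d) x : EReal) < (ψ n a ω : EReal) ∧
                  (ψ n a ω : EReal) ≤ uNE (green d 0 0) (n ^ d) y}).toReal)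
      atTop
      (nhds ((volume (rect d lo hi)).toReal * (Real.exp (-x) - expE y))) := by
  have hg : 0 < green d 0 0 :=
    zero_lt_one.trans_le ((one_le_truncatedGreen d 0).trans (truncatedGreen_le_green d 0 hd))
  have htail : ∀ n, ∀ a ∈ rectIdx d n lo hi, ∀ u : ℝ, P.real {ω | u < ψ n a ω} =
      normalTail (u / √(greenIn d (VN d n : Set (Zd d)) a a)) := by
    intro n a ha u
    have haV : a ∈ (VN d n : Set (Zd d)) := by
      classical exact (Finset.mem_filter.1 ha).1
    rw [← gaussianReal_Ioi (greenIn_self_pos d hd _ a haV), ← (hψ n).map_eq a,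
      map_measureReal_apply ((hψ n).1 a) measurableSet_Ioi]
    rfl
  induction y with
  | bot => exact absurd hxy not_lt_bot
  | top =>
    simp only [uNE, expE, if_true, le_top, and_true, EReal.coe_lt_coe_iff, sub_zero]
    refine (tendsto_sum_normalTail d hd lo hi x).congr fun n => ?_
    exact Finset.sum_congr rfl fun a ha => (htail n a ha _).symm
  | coe y =>
    simp only [uNE, expE, EReal.coe_ne_top, if_false, EReal.toReal_coe, EReal.coe_lt_coe_iff,
      EReal.coe_le_coe_iff, mul_sub] at hxy ⊢
    refine ((tendsto_sum_normalTail d hd lo hi x).sub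
      (tendsto_sum_normalTail d hd lo hi y)).congr' ?_
    have hbN : ∀ᶠ n : ℕ in atTop, 0 < bN (green d 0 0) (n ^ d) := by
      have h := (tendsto_mul_normalTail_uN hg (tendsto_pow_atTop (by omega : d ≠ 0))
        (v := fun _ => green d 0 0) (fun _ => hg) (by simp) 0).1
      filter_upwards [h.eventually_gt_atTop 0] with n hn
      simpa [uN] using (div_pos_iff_of_pos_right (Real.sqrt_pos.2 hg)).1 hn
    filter_upwards [hbN] with n hb
    rw [← Finset.sum_sub_distrib]
    refine Finset.sum_congr rfl fun a ha => ?_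
    have hu : uN (green d 0 0) (n ^ d) x ≤ uN (green d 0 0) (n ^ d) y := by
      unfold uN aN
      gcongr
    rw [← htail n a ha, ← htail n a ha, ← measureReal_def, ← measureReal_sdiff]
    · congr 1
      ext ω
      simp
    · exact fun ω hω => hu.trans_lt hω
    · exact measurableSet_lt measurable_const ((hψ n).1 a)
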